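/- A normal positive functional ρ on B(H) has Schmidt number not bigger than k if and only if φ̃_*(ρ) is positive for every k-positive map φ ∈ P^σ_k. -/

import Mathlib

set_option synthInstance.maxHeartbeats 1000000
set_option maxHeartbeats 1000000

noncomputable section

open scoped InnerProductSpace ComplexOrder
open ContinuousLinearMap

local notation "⟪" x ", " y "⟫" => @inner ℂ _ _ x y

namespace ChoiInf

variable {H : Type*} [NormedAddCommGroup H] [InnerProductSpace ℂ H] [CompleteSpace H]

/-- The rank one operator `x ⊠ y : z ↦ (z|y)·x = ⟪y, z⟫ • x`
(inner products written with Mathlib's convention: conjugate linear in the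
first variable, so that the paper's `(z|y)` is `⟪y, z⟫`). -/
def rankOne (x y : H) : H →L[ℂ] H := (innerSL ℂ y).smulRight x

/-- The trace of an operator, computed relative to a Hilbert basis:
`Tr X = Σᵢ (X eᵢ | eᵢ) = Σᵢ ⟪eᵢ, X eᵢ⟫`.  (For trace class operators this does
not depend on the choice of basis.) -/
def tr {ι : Type*} (b : HilbertBasis ι ℂ H) (T : H →L[ℂ] H) : ℂ :=
  ∑' i, ⟪b i, T (b i)⟫

/-- The bilinear pairing `⟨A, B⟩ = Tr (A B)` between `B(H)` and `T(H)`. -/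
def pairing {ι : Type*} (b : HilbertBasis ι ℂ H) (A T : H →L[ℂ] H) : ℂ :=
  tr b (A ∘L T)

/-- Trace class operators, characterized by nuclear representations
`T = Σₙ xₙ ⊠ yₙ` with `Σₙ ‖xₙ‖‖yₙ‖ < ∞`. -/
def IsTraceClass (T : H →L[ℂ] H) : Prop :=
  ∃ x y : ℕ → H, Summable (fun n => ‖x n‖ * ‖y n‖) ∧
    ∀ z, T z = ∑' n, ⟪y n, z⟫ • x n

/-- The trace norm, as the infimum of `Σₙ ‖xₙ‖‖yₙ‖` over all nuclear
representations `T = Σₙ xₙ ⊠ yₙ`. -/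
def traceNorm (T : H →L[ℂ] H) : ℝ :=
  sInf {c : ℝ | ∃ x y : ℕ → H, HasSum (fun n => ‖x n‖ * ‖y n‖) c ∧
    ∀ z, T z = ∑' n, ⟪y n, z⟫ • x n}

/-- `(Φ, Φst)` is a dual pair:  `Φst` preserves the trace class and
`⟨Φ A, T⟩ = ⟨A, Φst T⟩` for all trace class `T`.  A linear map `Φ` on `B(H)` is
normal (σ-weakly continuous) precisely when it admits such a predual map `Φst`. -/
def IsNormalPair {ι : Type*} (b : HilbertBasis ι ℂ H)
    (Φ Φst : (H →L[ℂ] H) →ₗ[ℂ] (H →L[ℂ] H)) : Prop :=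
  (∀ T, IsTraceClass T → IsTraceClass (Φst T)) ∧
    ∀ A T, IsTraceClass T → pairing b (Φ A) T = pairing b A (Φst T)

/-- Positivity of a `k × k` matrix of operators, i.e. positivity of the
corresponding operator on `H ⊕ ⋯ ⊕ H`. -/
def MatPos {k : ℕ} (A : Fin k → Fin k → (H →L[ℂ] H)) : Prop :=
  ∀ v : Fin k → H, 0 ≤ ∑ i, ∑ j, ⟪v i, A i j (v j)⟫

/-- The operator on `H ⊕ ⋯ ⊕ H` given by a `k × k` matrix of operators has norm `≤ c`. -/
def matNormLe {k : ℕ} (A : Fin k → Fin k → (H →L[ℂ] H)) (c : ℝ) : Prop :=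
  ∀ v w : Fin k → H,
    ‖∑ i, ∑ j, ⟪w i, A i j (v j)⟫‖ ≤
      c * Real.sqrt (∑ i, ‖v i‖ ^ 2) * Real.sqrt (∑ i, ‖w i‖ ^ 2)

/-- A von Neumann algebra is a factor when its center consists of the scalars. -/
def IsFactor (M : VonNeumannAlgebra H) : Prop :=
  ∀ T ∈ M, T ∈ M.commutant → ∃ c : ℂ, T = c • (1 : H →L[ℂ] H)

/-- `x0` is a cyclic vector for `M`. -/
def Cyclic (M : VonNeumannAlgebra H) (x0 : H) : Prop :=
  Dense {y : H | ∃ A ∈ M, A x0 = y}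

/-- `x0` is a separating vector for `M`. -/
def Separating (M : VonNeumannAlgebra H) (x0 : H) : Prop :=
  ∀ A ∈ M, A x0 = 0 → A = 0

/-- `Φ` restricts on `alg(M', M)` to the map `φ̃ : A'B ↦ A'·φ(B)`.
(Maps `φ : M → M` are encoded as linear maps on `B(H)` sending `M` into `M`;
only the restriction to `M` is relevant.) -/
def ExtendsTilde (M : VonNeumannAlgebra H)
    (φ Φ : (H →L[ℂ] H) →ₗ[ℂ] (H →L[ℂ] H)) : Prop :=
  ∀ A' ∈ M.commutant, ∀ B ∈ M, Φ (A' * B) = A' * φ B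

/-- The space `CB^σ_ε(M)` of maps `φ : M → M` such that `φ̃` extends to a normal
map on `B(H)`. -/
def CBSigmaE {ι : Type*} (b : HilbertBasis ι ℂ H) (M : VonNeumannAlgebra H) :
    Set ((H →L[ℂ] H) →ₗ[ℂ] (H →L[ℂ] H)) :=
  {φ | (∀ B ∈ M, φ B ∈ M) ∧
    ∃ Φ Φst, ExtendsTilde M φ Φ ∧ IsNormalPair b Φ Φst}

/-- `φ` is completely positive as a map on `M`. -/
def IsCPOn (M : VonNeumannAlgebra H) (φ : (H →L[ℂ] H) →ₗ[ℂ] (H →L[ℂ] H)) : Prop :=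
  ∀ (k : ℕ) (A : Fin k → Fin k → (H →L[ℂ] H)), (∀ i j, A i j ∈ M) →
    MatPos A → MatPos fun i j => φ (A i j)

/-- `φ` is completely positive (on all of `B(H)`). -/
def IsCPFull (φ : (H →L[ℂ] H) →ₗ[ℂ] (H →L[ℂ] H)) : Prop :=
  ∀ (k : ℕ) (A : Fin k → Fin k → (H →L[ℂ] H)), MatPos A → MatPos fun i j => φ (A i j)

/-- `c` is a completely bounded bound for `φ` as a map on `M`. -/
def CBBoundOn (M : VonNeumannAlgebra H) (φ : (H →L[ℂ] H) →ₗ[ℂ] (H →L[ℂ] H))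
    (c : ℝ) : Prop :=
  ∀ (k : ℕ) (A : Fin k → Fin k → (H →L[ℂ] H)), (∀ i j, A i j ∈ M) →
    matNormLe A 1 → matNormLe (fun i j => φ (A i j)) c

/-- The completely bounded norm of `φ` as a map on `M`. -/
def cbNormOn (M : VonNeumannAlgebra H) (φ : (H →L[ℂ] H) →ₗ[ℂ] (H →L[ℂ] H)) : ℝ :=
  sInf {c : ℝ | 0 ≤ c ∧ CBBoundOn M φ c}

/-- `φ` is completely bounded as a map on `M`. -/
def IsCBOn (M : VonNeumannAlgebra H) (φ : (H →L[ℂ] H) →ₗ[ℂ] (H →L[ℂ] H)) : Prop :=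
  ∃ c, 0 ≤ c ∧ CBBoundOn M φ c

/-- `φ` is normal as a map on `M`: every normal functional composed with `φ`
is again normal (i.e. implemented by a trace class operator). -/
def NormalOn {ι : Type*} (b : HilbertBasis ι ℂ H) (M : VonNeumannAlgebra H)
    (φ : (H →L[ℂ] H) →ₗ[ℂ] (H →L[ℂ] H)) : Prop :=
  ∀ T, IsTraceClass T → ∃ T', IsTraceClass T' ∧
    ∀ A ∈ M, pairing b (φ A) T = pairing b A T'

/-- The map `Ad_V : X ↦ V* X V`. -/
def AdL (V : H →L[ℂ] H) : (H →L[ℂ] H) →ₗ[ℂ] (H →L[ℂ] H) where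
  toFun X := star V * X * V
  map_add' X Y := by simp [add_mul, mul_add]
  map_smul' c X := by simp [smul_mul_assoc, mul_smul_comm]

/-- `p` is a minimal (nonzero) projection in `M`. -/
def IsMinimalProjection (M : VonNeumannAlgebra H) (p : H →L[ℂ] H) : Prop :=
  p ∈ M ∧ IsIdempotentElem p ∧ IsSelfAdjoint p ∧ p ≠ 0 ∧
    ∀ q, q ∈ M → IsIdempotentElem q → IsSelfAdjoint q → q ≠ 0 →
      q * p = q → p * q = q → q = p

/-- A factor is of type I precisely when it contains a minimal projection. -/
def IsTypeI (M : VonNeumannAlgebra H) : Prop :=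
  ∃ p, IsMinimalProjection M p




variable {K : Type*} [NormedAddCommGroup K] [InnerProductSpace ℂ K] [CompleteSpace K]

/-- `T` is a Hilbert–Schmidt operator (relative to a Hilbert basis `e`;
this does not depend on the choice of `e`). -/
def IsHS {ι : Type*} (e : HilbertBasis ι ℂ K) (T : K →L[ℂ] K) : Prop :=
  Summable fun i => ‖T (e i)‖ ^ 2

/-- A model of the Hilbert space `HS(K)` of Hilbert–Schmidt operators on `K`,
with `B(K)` acting by left multiplications `Lmul` and right multiplications
`Rmul`.  `toOp` regards a vector of `H` as an operator on `K`; its range is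
exactly the set of Hilbert–Schmidt operators, and the inner product of `H` is
`(x|y) = Tr (x y*)`, i.e. `⟪x, y⟫ = Σᵢ ⟪x eᵢ, y eᵢ⟫`. -/
structure HSModel {ι : Type*} (e : HilbertBasis ι ℂ K) (H : Type*)
    [NormedAddCommGroup H] [InnerProductSpace ℂ H] [CompleteSpace H] where
  toOp : H →ₗ[ℂ] (K →L[ℂ] K)
  inj : Function.Injective toOp
  mem_range : ∀ T : K →L[ℂ] K, IsHS e T ↔ ∃ x : H, toOp x = T
  inner_eq : ∀ x y : H, ⟪x, y⟫ = ∑' i, ⟪toOp x (e i), toOp y (e i)⟫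
  Lmul : (K →L[ℂ] K) → (H →L[ℂ] H)
  Lmul_eq : ∀ a x, toOp (Lmul a x) = a ∘L toOp x
  Rmul : (K →L[ℂ] K) → (H →L[ℂ] H)
  Rmul_eq : ∀ a x, toOp (Rmul a x) = toOp x ∘L a

/-- The operator `T` has rank at most `k`. -/
def rankLE (T : K →L[ℂ] K) (k : ℕ) : Prop :=
  Module.rank ℂ (LinearMap.range (T : K →ₗ[ℂ] K)) ≤ (k : Cardinal)

variable {H : Type*} [NormedAddCommGroup H] [InnerProductSpace ℂ H] [CompleteSpace H]
  {ι : Type*} {e : HilbertBasis ι ℂ K}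

/-- `Φ` restricts to the map `φ̃ : R_y L_x ↦ R_y L_{φ(x)}` on `alg(M', M)` for
`M = L_{B(K)}`. -/
def HSExt (m : HSModel e H) (φ : (K →L[ℂ] K) →ₗ[ℂ] (K →L[ℂ] K))
    (Φ : (H →L[ℂ] H) →ₗ[ℂ] (H →L[ℂ] H)) : Prop :=
  ∀ a x : K →L[ℂ] K, Φ (m.Rmul a ∘L m.Lmul x) = m.Rmul a ∘L m.Lmul (φ x)

/-- `φ` is `k`-positive. -/
def kPos (k : ℕ) (φ : (K →L[ℂ] K) →ₗ[ℂ] (K →L[ℂ] K)) : Prop :=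
  ∀ A : Fin k → Fin k → (K →L[ℂ] K), MatPos A → MatPos fun i j => φ (A i j)

/-- `φ` is completely bounded (as a map on all of `B(K)`). -/
def IsCBFullK (φ : (K →L[ℂ] K) →ₗ[ℂ] (K →L[ℂ] K)) : Prop :=
  ∃ c, 0 ≤ c ∧ ∀ (k : ℕ) (A : Fin k → Fin k → (K →L[ℂ] K)),
    matNormLe A 1 → matNormLe (fun i j => φ (A i j)) c

/-- `φ` belongs to `CB^σ(B(K))`: it is normal and completely bounded. -/
def NormalCB (e : HilbertBasis ι ℂ K) (φ : (K →L[ℂ] K) →ₗ[ℂ] (K →L[ℂ] K)) : Prop :=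
  (∃ φst, IsNormalPair e φ φst) ∧ IsCBFullK φ

/-- The cone `𝒮_k` of `T(H)`: the trace-norm closed convex cone generated by
the `ω_{x,x} = x ⊠ x` with `rank x ≤ k` (rank as an operator on `K`). -/
def SchmidtCone (m : HSModel e H) (k : ℕ) : Set (H →L[ℂ] H) :=
  {T | ∀ ε : ℝ, 0 < ε → ∃ (n : ℕ) (x : Fin n → H),
    (∀ i, rankLE (m.toOp (x i)) k) ∧
      traceNorm (T - ∑ i, rankOne (x i) (x i)) < ε}

/-- `ψ` belongs to the convex cone `𝔼_k` generated by the maps `Ad_V` with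
`rank V ≤ k`. -/
def InEk (k : ℕ) (ψ : (K →L[ℂ] K) →ₗ[ℂ] (K →L[ℂ] K)) : Prop :=
  ∃ (n : ℕ) (V : Fin n → (K →L[ℂ] K)), (∀ i, rankLE (V i) k) ∧
    ∀ x, ψ x = ∑ i, star (V i) * x * V i

/-- `φ` (with Choi trace-class operator `Dphi = D_φ`) is `k`-superpositive:
it lies in the `‖·‖_D`-closure of the cone `𝔼_k`, where `‖ψ‖_D = ‖D_ψ‖_{T(H)}`. -/
def kSuper {ιH : Type*} (bH : HilbertBasis ιH ℂ H) (m : HSModel e H) (x0 : H)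
    (k : ℕ) (Dphi : H →L[ℂ] H) : Prop :=
  ∀ ε : ℝ, 0 < ε → ∃ ψ Ψ Ψst, InEk k ψ ∧ HSExt m ψ Ψ ∧ IsNormalPair bH Ψ Ψst ∧
    traceNorm (Dphi - Ψst (rankOne x0 x0)) < ε

set_option linter.unusedSectionVars false

section Nuclear

variable {H : Type*} [NormedAddCommGroup H] [InnerProductSpace ℂ H] [CompleteSpace H]

@[simp]
lemma rankOne_apply (x y z : H) : rankOne x y z = ⟪y, z⟫ • x := rfl

/-- `T` has a nuclear representation `Σₙ xₙ ⊠ yₙ` with `Σₙ ‖xₙ‖‖yₙ‖ = c`. -/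
def NuclearRep (T : H →L[ℂ] H) (c : ℝ) : Prop :=
  ∃ x y : ℕ → H, HasSum (fun n => ‖x n‖ * ‖y n‖) c ∧
    ∀ z, HasSum (fun n => ⟪y n, z⟫ • x n) (T z)

lemma summable_inner_smul {κ : Type*} {x y : κ → H}
    (h : Summable fun n => ‖x n‖ * ‖y n‖) (z : H) :
    Summable fun n => ⟪y n, z⟫ • x n := by
  refine Summable.of_norm_bounded (h.mul_right ‖z‖) fun n => ?_
  rw [norm_smul]
  calc ‖⟪y n, z⟫‖ * ‖x n‖ ≤ (‖y n‖ * ‖z‖) * ‖x n‖ := by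
        gcongr; exact norm_inner_le_norm _ _
    _ = _ := by ring

lemma nuclearRep_iff {T : H →L[ℂ] H} {c : ℝ} :
    NuclearRep T c ↔ ∃ x y : ℕ → H, HasSum (fun n => ‖x n‖ * ‖y n‖) c ∧
      ∀ z, T z = ∑' n, ⟪y n, z⟫ • x n := by
  constructor
  · rintro ⟨x, y, h, hT⟩
    exact ⟨x, y, h, fun z => (hT z).tsum_eq.symm⟩
  · rintro ⟨x, y, h, hT⟩
    exact ⟨x, y, h, fun z => hT z ▸ (summable_inner_smul h.summable z).hasSum⟩

lemma isTraceClass_iff {T : H →L[ℂ] H} : IsTraceClass T ↔ ∃ c, NuclearRep T c := by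
  simp only [nuclearRep_iff]
  constructor
  · rintro ⟨x, y, ⟨c, h⟩, hT⟩
    exact ⟨c, x, y, h, hT⟩
  · rintro ⟨c, x, y, h, hT⟩
    exact ⟨x, y, h.summable, hT⟩

lemma NuclearRep.isTraceClass {T : H →L[ℂ] H} {c : ℝ} (h : NuclearRep T c) :
    IsTraceClass T :=
  isTraceClass_iff.2 ⟨c, h⟩

lemma NuclearRep.nonneg {T : H →L[ℂ] H} {c : ℝ} (h : NuclearRep T c) : 0 ≤ c := by
  obtain ⟨x, y, h, -⟩ := h
  exact h.nonneg fun n => by positivity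

lemma traceNorm_le {T : H →L[ℂ] H} {c : ℝ} (h : NuclearRep T c) : traceNorm T ≤ c := by
  refine csInf_le ⟨0, ?_⟩ (nuclearRep_iff.1 h)
  intro d hd
  exact (nuclearRep_iff.2 hd).nonneg

lemma exists_nuclearRep_lt {T : H →L[ℂ] H} (hT : IsTraceClass T) {ε : ℝ}
    (h : traceNorm T < ε) : ∃ c < ε, NuclearRep T c := by
  obtain ⟨d, hd⟩ := isTraceClass_iff.1 hT
  obtain ⟨c, hc, hlt⟩ := exists_lt_of_csInf_lt ⟨d, nuclearRep_iff.1 hd⟩ h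
  exact ⟨c, hlt, nuclearRep_iff.2 hc⟩

lemma NuclearRep.zero : NuclearRep (0 : H →L[ℂ] H) 0 :=
  ⟨0, 0, by simp, fun z => by simp⟩

lemma NuclearRep.rankOne (x y : H) : NuclearRep (rankOne x y) (‖x‖ * ‖y‖) := by
  refine ⟨fun n => if n = 0 then x else 0, fun n => if n = 0 then y else 0, ?_, fun z => ?_⟩
  · convert hasSum_ite_eq (0 : ℕ) (‖x‖ * ‖y‖) using 2 with n
    by_cases hn : n = 0 <;> simp [hn]
  · rw [rankOne_apply]
    convert hasSum_ite_eq (0 : ℕ) (⟪y, z⟫ • x) using 2 with n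
    by_cases hn : n = 0 <;> simp [hn]

lemma NuclearRep.add {S T : H →L[ℂ] H} {c d : ℝ} (hS : NuclearRep S c)
    (hT : NuclearRep T d) : NuclearRep (S + T) (c + d) := by
  obtain ⟨x, y, h, hz⟩ := hS
  obtain ⟨x', y', h', hz'⟩ := hT
  let eq := Equiv.natSumNatEquivNat.symm
  refine ⟨Sum.elim x x' ∘ eq, Sum.elim y y' ∘ eq, ?_, fun z => ?_⟩
  · refine (eq.hasSum_iff (f := fun s => ‖Sum.elim x x' s‖ * ‖Sum.elim y y' s‖)).2 ?_
    exact HasSum.sum h h'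
  · refine (eq.hasSum_iff (f := fun s => ⟪Sum.elim y y' s, z⟫ • Sum.elim x x' s)).2 ?_
    exact HasSum.sum (hz z) (hz' z)

lemma NuclearRep.sum {κ : Type*} (s : Finset κ) {T : κ → H →L[ℂ] H} {c : κ → ℝ}
    (h : ∀ i ∈ s, NuclearRep (T i) (c i)) : NuclearRep (∑ i ∈ s, T i) (∑ i ∈ s, c i) := by
  classical
  induction s using Finset.induction_on with
  | empty => simpa using NuclearRep.zero
  | insert a s ha ih =>
    rw [Finset.sum_insert ha, Finset.sum_insert ha]
    exact (h a (by simp)).add (ih fun i hi => h i (by simp [hi]))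

lemma NuclearRep.comp {T : H →L[ℂ] H} {x y : ℕ → H} (h : Summable fun n => ‖x n‖ * ‖y n‖)
    (hT : ∀ z, HasSum (fun n => ⟪y n, z⟫ • x n) (T z)) (U V : H →L[ℂ] H) :
    (Summable fun n => ‖U (x n)‖ * ‖adjoint V (y n)‖) ∧
      ∀ z, HasSum (fun n => ⟪adjoint V (y n), z⟫ • U (x n)) ((U * T * V) z) := by
  constructor
  · refine Summable.of_nonneg_of_le (fun n => by positivity) (fun n => ?_)
      (h.mul_left (‖U‖ * ‖adjoint V‖))
    calc ‖U (x n)‖ * ‖adjoint V (y n)‖ ≤ (‖U‖ * ‖x n‖) * (‖adjoint V‖ * ‖y n‖) := by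
          gcongr <;> exact le_opNorm _ _
      _ = _ := by ring
  · intro z
    have := (hT (V z)).mapL U
    simpa [adjoint_inner_left] using this

lemma IsTraceClass.mul_mul {T : H →L[ℂ] H} (hT : IsTraceClass T) (U V : H →L[ℂ] H) :
    IsTraceClass (U * T * V) := by
  obtain ⟨c, x, y, h, hz⟩ := isTraceClass_iff.1 hT
  obtain ⟨⟨d, h1⟩, h2⟩ := NuclearRep.comp h.summable hz U V
  exact isTraceClass_iff.2 ⟨d, _, _, h1, h2⟩

lemma IsTraceClass.add {S T : H →L[ℂ] H} (hS : IsTraceClass S) (hT : IsTraceClass T) :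
    IsTraceClass (S + T) := by
  obtain ⟨c, hc⟩ := isTraceClass_iff.1 hS
  obtain ⟨d, hd⟩ := isTraceClass_iff.1 hT
  exact (hc.add hd).isTraceClass

end Nuclear

section Truncation

variable {H : Type*} [NormedAddCommGroup H] [InnerProductSpace ℂ H] [CompleteSpace H]
  {κ : Type*}

/-- The projection `y ↦ Σ_{i ∈ s} (y|bᵢ) bᵢ` onto the span of finitely many vectors. -/
def truncation (b : κ → H) (s : Finset κ) : H →L[ℂ] H := ∑ i ∈ s, rankOne (b i) (b i)

lemma truncation_apply (b : κ → H) (s : Finset κ) (y : H) :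
    truncation b s y = ∑ i ∈ s, ⟪b i, y⟫ • b i := by
  simp [truncation]

lemma inner_truncation_left (b : κ → H) (s : Finset κ) (y z : H) :
    ⟪truncation b s y, z⟫ = ∑ i ∈ s, ⟪y, b i⟫ * ⟪b i, z⟫ := by
  simp [truncation_apply, mul_comm]

lemma inner_truncation_right (b : κ → H) (s : Finset κ) (y z : H) :
    ⟪y, truncation b s z⟫ = ∑ i ∈ s, ⟪y, b i⟫ * ⟪b i, z⟫ := by
  simp [truncation_apply, mul_comm]

lemma norm_truncation_le {b : κ → H} (hb : Orthonormal ℂ b) (s : Finset κ) (y : H) :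
    ‖truncation b s y‖ ≤ ‖y‖ := by
  have h1 : ‖truncation b s y‖ ^ 2 = ∑ i ∈ s, ‖⟪b i, y⟫‖ ^ 2 := by
    have := hb.inner_sum (fun i => ⟪b i, y⟫) (fun i => ⟪b i, y⟫) s
    rw [← truncation_apply, inner_self_eq_norm_sq_to_K] at this
    have h2 : ((‖truncation b s y‖ ^ 2 : ℝ) : ℂ) = ((∑ i ∈ s, ‖⟪b i, y⟫‖ ^ 2 : ℝ) : ℂ) := by
      push_cast
      refine Eq.trans this (Finset.sum_congr rfl fun i _ => ?_)
      rw [← Complex.normSq_eq_conj_mul_self, Complex.normSq_eq_norm_sq]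
      simp
    exact_mod_cast h2
  have h2 := hb.sum_inner_products_le y (s := s)
  exact le_of_sq_le_sq (by rw [h1]; exact h2) (norm_nonneg _)

lemma tendsto_truncation (b : HilbertBasis κ ℂ H) (y : H) :
    Filter.Tendsto (fun s => truncation b s y) Filter.atTop (nhds y) := by
  have := b.hasSum_repr y
  simp only [truncation_apply, ← HilbertBasis.repr_apply_apply]
  exact this

lemma hasSum_inner_comp (b : HilbertBasis κ ℂ H) {T : H →L[ℂ] H} {x y : ℕ → H}
    (h : Summable fun n => ‖x n‖ * ‖y n‖)
    (hT : ∀ z, HasSum (fun n => ⟪y n, z⟫ • x n) (T z)) (A : H →L[ℂ] H) :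
    HasSum (fun i => ⟪b i, (A ∘L T) (b i)⟫) (∑' n, ⟪y n, A (x n)⟫) := by
  have key : ∀ s : Finset κ, ∑ i ∈ s, ⟪b i, (A ∘L T) (b i)⟫
      = ∑' n, ⟪truncation b s (y n), A (x n)⟫ := by
    intro s
    have h1 : ∀ i, HasSum (fun n => ⟪y n, b i⟫ * ⟪b i, A (x n)⟫) ⟪b i, (A ∘L T) (b i)⟫ := by
      intro i
      have := ((hT (b i)).mapL A).mapL (innerSL ℂ (b i))
      simpa [inner_smul_right] using this
    have h2 := hasSum_sum (s := s) fun i _ => h1 i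
    rw [← h2.tsum_eq]
    simp only [inner_truncation_left]
  have : Filter.Tendsto (fun s : Finset κ => ∑' n, ⟪truncation b s (y n), A (x n)⟫)
      Filter.atTop (nhds (∑' n, ⟪y n, A (x n)⟫)) := by
    refine tendsto_tsum_of_dominated_convergence (h.mul_left ‖A‖) (fun n => ?_)
      (Filter.Eventually.of_forall fun s n => ?_)
    · exact (tendsto_truncation b (y n)).inner tendsto_const_nhds
    · calc ‖⟪truncation b s (y n), A (x n)⟫‖ ≤ ‖truncation b s (y n)‖ * ‖A (x n)‖ :=
            norm_inner_le_norm _ _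
        _ ≤ ‖y n‖ * (‖A‖ * ‖x n‖) := by
            gcongr
            · exact norm_truncation_le b.orthonormal s _
            · exact le_opNorm _ _
        _ = _ := by ring
  simp only [← key] at this
  exact this

lemma norm_pairing_le (b : HilbertBasis κ ℂ H) {T : H →L[ℂ] H} {c : ℝ} (h : NuclearRep T c)
    (A : H →L[ℂ] H) : ‖pairing b A T‖ ≤ ‖A‖ * c := by
  obtain ⟨x, y, h, hT⟩ := h
  rw [pairing, tr, (hasSum_inner_comp b h.summable hT A).tsum_eq]
  refine tsum_of_norm_bounded (h.mul_left ‖A‖) fun n => ?_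
  calc ‖⟪y n, A (x n)⟫‖ ≤ ‖y n‖ * ‖A (x n)‖ := norm_inner_le_norm _ _
    _ ≤ ‖y n‖ * (‖A‖ * ‖x n‖) := by gcongr; exact le_opNorm _ _
    _ = _ := by ring

lemma summable_pairing (b : HilbertBasis κ ℂ H) {T : H →L[ℂ] H} (h : IsTraceClass T)
    (A : H →L[ℂ] H) : Summable fun i => ⟪b i, (A ∘L T) (b i)⟫ := by
  obtain ⟨c, x, y, h, hT⟩ := isTraceClass_iff.1 h
  exact (hasSum_inner_comp b h.summable hT A).summable

lemma pairing_add_left (b : HilbertBasis κ ℂ H) {T : H →L[ℂ] H} (h : IsTraceClass T)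
    (A B : H →L[ℂ] H) : pairing b (A + B) T = pairing b A T + pairing b B T := by
  simp only [pairing, tr]
  rw [← (summable_pairing b h A).tsum_add (summable_pairing b h B)]
  simp

lemma pairing_add_right (b : HilbertBasis κ ℂ H) {S T : H →L[ℂ] H} (hS : IsTraceClass S)
    (hT : IsTraceClass T) (A : H →L[ℂ] H) :
    pairing b A (S + T) = pairing b A S + pairing b A T := by
  simp only [pairing, tr]
  rw [← (summable_pairing b hS A).tsum_add (summable_pairing b hT A)]
  simp

lemma pairing_mul_mul (b : HilbertBasis κ ℂ H) {T : H →L[ℂ] H} (h : IsTraceClass T)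
    (A U V : H →L[ℂ] H) : pairing b (U * A * V) T = pairing b A (V * T * U) := by
  obtain ⟨c, x, y, h, hT⟩ := isTraceClass_iff.1 h
  obtain ⟨h1, h2⟩ := NuclearRep.comp h.summable hT V U
  simp only [pairing, tr]
  rw [(hasSum_inner_comp b h.summable hT (U * A * V)).tsum_eq,
    (hasSum_inner_comp b h1 h2 A).tsum_eq]
  simp [adjoint_inner_left]

lemma pairing_rankOne_left (b : HilbertBasis κ ℂ H) (x y : H) (S : H →L[ℂ] H) :
    pairing b (rankOne x y) S = ⟪y, S x⟫ := by
  have := b.tsum_inner_mul_inner (adjoint S y) x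
  simp only [adjoint_inner_left] at this
  rw [pairing, tr, ← this]
  simp

lemma pairing_rankOne_right (b : HilbertBasis κ ℂ H) (x y : H) (A : H →L[ℂ] H) :
    pairing b A (rankOne x y) = ⟪y, A x⟫ := by
  have := b.tsum_inner_mul_inner y (A x)
  rw [pairing, tr, ← this]
  simp

lemma isPositive_of_inner_nonneg {T : H →L[ℂ] H} (h : ∀ y, 0 ≤ ⟪y, T y⟫) : T.IsPositive := by
  rw [isPositive_iff_complex]
  intro y
  have hy : 0 ≤ ⟪T y, y⟫ := by
    rw [← inner_conj_symm]
    exact star_nonneg_iff.2 (h y)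
  obtain ⟨h1, h2⟩ := Complex.nonneg_iff.1 hy
  exact ⟨Complex.ext (by simp) (by simp [← h2]), h1⟩

end Truncation

section Elementary

variable {H : Type*} [NormedAddCommGroup H] [InnerProductSpace ℂ H] [CompleteSpace H]
  {κ : Type*} {σ : Type*} [Fintype σ]

/-- The elementary operator `X ↦ Σₚ Uₚ X Vₚ`. -/
def elementary (U V : σ → H →L[ℂ] H) : (H →L[ℂ] H) →ₗ[ℂ] (H →L[ℂ] H) :=
  ∑ p, LinearMap.mulLeftRight ℂ (U p, V p)

lemma elementary_apply (U V : σ → H →L[ℂ] H) (X : H →L[ℂ] H) :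
    elementary U V X = ∑ p, U p * X * V p := by
  simp [elementary, LinearMap.mulLeftRight_apply]

lemma isTraceClass_sum {T : σ → H →L[ℂ] H} (s : Finset σ) (h : ∀ p, IsTraceClass (T p)) :
    IsTraceClass (∑ p ∈ s, T p) :=
  Finset.sum_induction T IsTraceClass (fun _ _ => IsTraceClass.add) NuclearRep.zero.isTraceClass
    fun p _ => h p

lemma pairing_zero_left (b : HilbertBasis κ ℂ H) (T : H →L[ℂ] H) : pairing b 0 T = 0 := by
  simp [pairing, tr]

lemma pairing_zero_right (b : HilbertBasis κ ℂ H) (A : H →L[ℂ] H) : pairing b A 0 = 0 := by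
  simp [pairing, tr]

lemma pairing_sum_left (b : HilbertBasis κ ℂ H) {T : H →L[ℂ] H} (h : IsTraceClass T)
    (s : Finset σ) (A : σ → H →L[ℂ] H) :
    pairing b (∑ p ∈ s, A p) T = ∑ p ∈ s, pairing b (A p) T := by
  classical
  induction s using Finset.induction_on with
  | empty => simp [pairing_zero_left]
  | insert p s hp ih => rw [Finset.sum_insert hp, Finset.sum_insert hp, pairing_add_left b h, ih]

lemma pairing_sum_right (b : HilbertBasis κ ℂ H) {T : σ → H →L[ℂ] H}
    (h : ∀ p, IsTraceClass (T p)) (s : Finset σ) (A : H →L[ℂ] H) :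
    pairing b A (∑ p ∈ s, T p) = ∑ p ∈ s, pairing b A (T p) := by
  classical
  induction s using Finset.induction_on with
  | empty => simp [pairing_zero_right]
  | insert p s hp ih =>
    rw [Finset.sum_insert hp, Finset.sum_insert hp,
      pairing_add_right b (h p) (isTraceClass_sum s h), ih]

lemma isNormalPair_elementary (b : HilbertBasis κ ℂ H) (U V : σ → H →L[ℂ] H) :
    IsNormalPair b (elementary U V) (elementary V U) := by
  refine ⟨fun T hT => ?_, fun A T hT => ?_⟩
  · rw [elementary_apply]
    exact isTraceClass_sum _ fun p => hT.mul_mul _ _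
  · rw [elementary_apply, elementary_apply, pairing_sum_left b hT,
      pairing_sum_right b fun p => hT.mul_mul _ _]
    exact Finset.sum_congr rfl fun p _ => pairing_mul_mul b hT _ _ _

lemma sqrt_sum_norm_sq_le {k : ℕ} (V : H →L[ℂ] H) (v : Fin k → H) :
    Real.sqrt (∑ i, ‖V (v i)‖ ^ 2) ≤ ‖V‖ * Real.sqrt (∑ i, ‖v i‖ ^ 2) := by
  rw [← Real.sqrt_sq (norm_nonneg V), ← Real.sqrt_mul (by positivity), Finset.mul_sum]
  refine Real.sqrt_le_sqrt (Finset.sum_le_sum fun i _ => ?_)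
  rw [← mul_pow]
  gcongr
  exact le_opNorm _ _

lemma isCBFullK_elementary (U V : σ → H →L[ℂ] H) : IsCBFullK (elementary U V) := by
  refine ⟨∑ p, ‖V p‖ * ‖adjoint (U p)‖, by positivity, fun k A hA v w => ?_⟩
  have h1 : ∑ i, ∑ j, ⟪w i, elementary U V (A i j) (v j)⟫
      = ∑ p, ∑ i, ∑ j, ⟪adjoint (U p) (w i), A i j (V p (v j))⟫ := by
    simp only [elementary_apply, adjoint_inner_left, _root_.sum_apply, inner_sum]
    rw [Finset.sum_comm]
    simp only [Finset.sum_comm (s := (Finset.univ : Finset σ))]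
    rw [Finset.sum_comm]
    rfl
  rw [h1, Finset.sum_mul, Finset.sum_mul]
  refine norm_sum_le_of_le _ fun p _ => (hA _ _).trans ?_
  rw [one_mul]
  calc _ ≤ (‖V p‖ * Real.sqrt (∑ i, ‖v i‖ ^ 2)) *
        (‖adjoint (U p)‖ * Real.sqrt (∑ i, ‖w i‖ ^ 2)) := by
        gcongr <;> exact sqrt_sum_norm_sq_le _ _
    _ = _ := by ring

end Elementary

section Rank

variable {K : Type*} [NormedAddCommGroup K] [InnerProductSpace ℂ K] [CompleteSpace K]

lemma rankLE_of_forall_mem_span {T : K →L[ℂ] K} {k : ℕ} (f : Fin k → K)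
    (h : ∀ z, T z ∈ Submodule.span ℂ (Set.range f)) : rankLE T k := by
  have h1 : LinearMap.range (T : K →ₗ[ℂ] K) ≤ Submodule.span ℂ (Set.range f) := by
    rintro _ ⟨z, rfl⟩
    exact h z
  refine (Submodule.rank_mono h1).trans ((rank_span_le _).trans ?_)
  simpa using Cardinal.mk_range_le_lift (f := f)

lemma rankLE_sum_rankOne {k : ℕ} (p q : Fin k → K) : rankLE (∑ t, rankOne (p t) (q t)) k := by
  refine rankLE_of_forall_mem_span p fun z => ?_
  rw [_root_.sum_apply]
  exact Submodule.sum_mem _ fun t _ =>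
    Submodule.smul_mem _ _ (Submodule.subset_span (Set.mem_range_self t))

lemma exists_coeff_of_rankLE {T : K →L[ℂ] K} {k : ℕ} (h : rankLE T k) :
    ∃ (f : Fin k → K) (ξ : K → Fin k → ℂ), ∀ z, T z = ∑ l, ξ z l • f l := by
  set W := LinearMap.range (T : K →ₗ[ℂ] K)
  have : FiniteDimensional ℂ W :=
    Module.rank_lt_aleph0_iff.1 (lt_of_le_of_lt h (Cardinal.natCast_lt_aleph0))
  have hd : Module.finrank ℂ W ≤ k := Module.finrank_le_of_rank_le h
  let β := Module.finBasis ℂ W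
  let f : Fin k → K := fun l => if hl : (l : ℕ) < Module.finrank ℂ W then β ⟨l, hl⟩ else 0
  have hf : ∀ z, T z ∈ Submodule.span ℂ (Set.range f) := by
    intro z
    have h1 : T z = ∑ i, β.repr ⟨T z, z, rfl⟩ i • (β i : K) := by
      have := congrArg W.subtype (β.sum_repr ⟨T z, z, rfl⟩)
      simp only [map_sum, map_smul, Submodule.subtype_apply] at this
      exact this.symm
    rw [h1]
    refine Submodule.sum_mem _ fun i _ => Submodule.smul_mem _ _ (Submodule.subset_span ?_)
    exact ⟨Fin.castLE hd i, by simp [f]⟩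
  simp only [Submodule.mem_span_range_iff_exists_fun] at hf
  choose ξ hξ using hf
  exact ⟨f, ξ, fun z => (hξ z).symm⟩

end Rank

section Model

variable {K : Type*} [NormedAddCommGroup K] [InnerProductSpace ℂ K] [CompleteSpace K]
  {H : Type*} [NormedAddCommGroup H] [InnerProductSpace ℂ H] [CompleteSpace H]
  {ι : Type*} {e : HilbertBasis ι ℂ K}

lemma isHS_rankOne (e : HilbertBasis ι ℂ K) (p q : K) : IsHS e (rankOne p q) := by
  have := (e.orthonormal.inner_products_summable q).mul_right (‖p‖ ^ 2)
  refine this.congr fun i => ?_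
  rw [rankOne_apply, norm_smul, mul_pow, norm_inner_symm]

namespace HSModel

variable (m : HSModel e H)

/-- The vector of `H` representing the rank one operator `p ⊠ q` on `K`. -/
def ket (p q : K) : H := ((m.mem_range _).1 (isHS_rankOne e p q)).choose

@[simp]
lemma toOp_ket (p q : K) : m.toOp (m.ket p q) = rankOne p q :=
  ((m.mem_range _).1 (isHS_rankOne e p q)).choose_spec

lemma inner_ket_left (p q : K) (x : H) : ⟪m.ket p q, x⟫ = ⟪p, m.toOp x q⟫ := by
  have := e.tsum_inner_mul_inner (adjoint (m.toOp x) p) q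
  simp only [adjoint_inner_left] at this
  rw [m.inner_eq, ← this]
  simp

lemma inner_Rmul_rankOne (p q : K) (x z : H) :
    ⟪x, m.Rmul (rankOne p q) z⟫ = ⟪m.toOp x q, m.toOp z p⟫ := by
  have := e.tsum_inner_mul_inner q (adjoint (m.toOp x) (m.toOp z p))
  simp only [adjoint_inner_right] at this
  rw [m.inner_eq, ← this, m.Rmul_eq]
  simp

lemma inner_Lmul_left (a : K →L[ℂ] K) (x y : H) :
    ⟪m.Lmul a x, y⟫ = ⟪x, m.Lmul (adjoint a) y⟫ := by
  simp [m.inner_eq, m.Lmul_eq, adjoint_inner_right]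

lemma Lmul_ket (a : K →L[ℂ] K) (p q : K) : m.Lmul a (m.ket p q) = m.ket (a p) q := by
  apply m.inj
  ext z
  simp [m.Lmul_eq]

lemma ket_smul (c : ℂ) (p q : K) : m.ket (c • p) q = c • m.ket p q := by
  apply m.inj
  ext z
  simp [smul_comm c]

lemma Rmul_comp_Lmul (p q r s : K) :
    m.Rmul (rankOne s q) ∘L m.Lmul (rankOne p r) = rankOne (m.ket p q) (m.ket r s) := by
  ext x
  apply m.inj
  ext z
  simp [m.Rmul_eq, m.Lmul_eq, m.inner_ket_left]
  exact smul_comm _ _ _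

lemma orthonormal_ket {n : Type*} {ε : n → K} (hε : Orthonormal ℂ ε) :
    Orthonormal ℂ fun a : n × n => m.ket (ε a.1) (ε a.2) := by
  classical
  rw [orthonormal_iff_ite] at hε ⊢
  rintro ⟨i, j⟩ ⟨i', j'⟩
  simp only [inner_ket_left, toOp_ket, rankOne_apply, inner_smul_right, hε, Prod.mk.injEq]
  by_cases h1 : i = i' <;> by_cases h2 : j = j' <;> simp [h1, h2, eq_comm]

/-- The Hilbert basis of matrix units `eᵢ ⊠ eⱼ`. -/
def basis : HilbertBasis (ι × ι) ℂ H :=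
  HilbertBasis.mkOfOrthogonalEqBot (m.orthonormal_ket e.orthonormal) (by
    rw [Submodule.eq_bot_iff]
    intro x hx
    have h0 : ∀ i j, ⟪e i, m.toOp x (e j)⟫ = 0 := by
      intro i j
      rw [← m.inner_ket_left]
      exact hx _ (Submodule.subset_span ⟨(i, j), rfl⟩)
    have h1 : ∀ j, m.toOp x (e j) = 0 := by
      intro j
      rw [← e.repr.map_eq_zero_iff]
      ext i
      simpa [HilbertBasis.repr_apply_apply] using h0 i j
    have h2 : ⟪x, x⟫ = 0 := by
      rw [m.inner_eq]
      simp [h1]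
    exact inner_self_eq_zero.1 h2)

@[simp]
lemma basis_apply (a : ι × ι) : m.basis a = m.ket (e a.1) (e a.2) := by
  simp [basis]

lemma hsExt_elementary {σ : Type*} [Fintype σ] (U V : σ → K →L[ℂ] K) :
    HSExt m (elementary U V)
      (elementary (fun p => m.Lmul (U p)) fun p => m.Lmul (V p)) := by
  intro a x
  ext z
  apply m.inj
  ext w
  simp [elementary_apply, m.Lmul_eq, m.Rmul_eq]

end HSModel

end Model

section Forward

variable {K : Type*} [NormedAddCommGroup K] [InnerProductSpace ℂ K] [CompleteSpace K]
  {H : Type*} [NormedAddCommGroup H] [InnerProductSpace ℂ H] [CompleteSpace H]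
  {ι : Type*} {e : HilbertBasis ι ℂ K}

lemma matPos_rankOne {k : ℕ} (w : Fin k → K) : MatPos fun i j => rankOne (w i) (w j) := by
  intro v
  have : ∑ i, ∑ j, ⟪v i, rankOne (w i) (w j) (v j)⟫
      = star (∑ i, ⟪w i, v i⟫) * ∑ j, ⟪w j, v j⟫ := by
    simp only [rankOne_apply, inner_smul_right, star_sum, Finset.sum_mul_sum, RCLike.star_def,
      inner_conj_symm]
    exact Finset.sum_congr rfl fun i _ => Finset.sum_congr rfl fun j _ => mul_comm _ _
  rw [this]
  exact star_mul_self_nonneg _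

lemma kPos.sum_inner_nonneg {k : ℕ} {φ : (K →L[ℂ] K) →ₗ[ℂ] (K →L[ℂ] K)} (hφ : kPos k φ)
    {X : K →L[ℂ] K} (hX : rankLE X k) {κ : Type*} (s : Finset κ) (p q : κ → K) :
    0 ≤ ∑ i ∈ s, ∑ j ∈ s, ⟪X (q i), φ (rankOne (p i) (p j)) (X (q j))⟫ := by
  obtain ⟨f, ξ, hξ⟩ := exists_coeff_of_rankLE hX
  have h := hφ _ (matPos_rankOne fun l => ∑ i ∈ s, star (ξ (q i) l) • p i) f
  refine h.trans_eq ?_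
  have h1 : ∀ l l', rankOne (∑ i ∈ s, star (ξ (q i) l) • p i) (∑ i ∈ s, star (ξ (q i) l') • p i)
      = ∑ i ∈ s, ∑ j ∈ s, (star (ξ (q i) l) * ξ (q j) l') • rankOne (p i) (p j) := by
    intro l l'
    ext z
    simp only [rankOne_apply, sum_inner, inner_smul_left, RCLike.star_def, RingHomCompTriple.comp_apply,
      RingHom.id_apply, _root_.sum_apply, smul_apply, Finset.sum_mul, Finset.sum_smul,
      Finset.smul_sum, smul_smul]
    refine Finset.sum_congr rfl fun i _ => Finset.sum_congr rfl fun j _ => ?_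
    congr 1
    ring
  simp only [h1, map_sum, map_smul, _root_.sum_apply, smul_apply, inner_sum, inner_smul_right]
  simp only [hξ, map_sum, map_smul, inner_sum, sum_inner, inner_smul_right, inner_smul_left]
  calc _ = ∑ l, ∑ i ∈ s, ∑ l', ∑ j ∈ s, star (ξ (q i) l) * ξ (q j) l' *
        ⟪f l, φ (rankOne (p i) (p j)) (f l')⟫ :=
        Finset.sum_congr rfl fun l _ => Finset.sum_comm
    _ = ∑ i ∈ s, ∑ l, ∑ j ∈ s, ∑ l', star (ξ (q i) l) * ξ (q j) l' *
        ⟪f l, φ (rankOne (p i) (p j)) (f l')⟫ := by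
        rw [Finset.sum_comm]
        exact Finset.sum_congr rfl fun i _ => Finset.sum_congr rfl fun l _ => Finset.sum_comm
    _ = ∑ i ∈ s, ∑ j ∈ s, ∑ l, ∑ l', star (ξ (q i) l) * ξ (q j) l' *
        ⟪f l, φ (rankOne (p i) (p j)) (f l')⟫ :=
        Finset.sum_congr rfl fun i _ => Finset.sum_comm
    _ = _ := by
        refine Finset.sum_congr rfl fun i _ => Finset.sum_congr rfl fun j _ => ?_
        rw [Finset.sum_comm]
        refine Finset.sum_congr rfl fun l _ => ?_
        simp only [Finset.mul_sum]
        refine Finset.sum_congr rfl fun l' _ => ?_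
        simp only [RCLike.star_def]
        ring

lemma HSExt.inner_nonneg {m : HSModel e H} {k : ℕ} {φ : (K →L[ℂ] K) →ₗ[ℂ] (K →L[ℂ] K)}
    {Φ : (H →L[ℂ] H) →ₗ[ℂ] (H →L[ℂ] H)} (hφ : kPos k φ) (hΦ : HSExt m φ Φ) {x : H}
    (hx : rankLE (m.toOp x) k) {κ : Type*} (s : Finset κ) (p q : κ → K) :
    0 ≤ ⟪x, Φ (rankOne (∑ i ∈ s, m.ket (p i) (q i)) (∑ i ∈ s, m.ket (p i) (q i))) x⟫ := by
  have h1 : rankOne (∑ i ∈ s, m.ket (p i) (q i)) (∑ i ∈ s, m.ket (p i) (q i))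
      = ∑ i ∈ s, ∑ j ∈ s, m.Rmul (rankOne (q j) (q i)) ∘L m.Lmul (rankOne (p i) (p j)) := by
    ext z
    simp only [m.Rmul_comp_Lmul, rankOne_apply, _root_.sum_apply, sum_inner, Finset.sum_smul,
      Finset.smul_sum]
  rw [h1]
  simp only [map_sum, hΦ _ _, _root_.sum_apply, inner_sum, comp_apply, m.inner_Rmul_rankOne,
    m.Lmul_eq]
  exact hφ.sum_inner_nonneg hx s p q

lemma isTraceClass_sub_sum_rankOne {R : H →L[ℂ] H} (hR : IsTraceClass R) {n : ℕ} (x : Fin n → H) :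
    IsTraceClass (R - ∑ i, rankOne (x i) (x i)) := by
  rw [sub_eq_add_neg, ← Finset.sum_neg_distrib]
  refine hR.add (isTraceClass_sum _ fun i => ?_)
  have : -rankOne (x i) (x i) = rankOne (-x i) (x i) := by ext; simp
  rw [this]
  exact (NuclearRep.rankOne _ _).isTraceClass

lemma nonneg_of_forall_exists_norm_sub_le {z : ℂ}
    (h : ∀ ε : ℝ, 0 < ε → ∃ w : ℂ, 0 ≤ w ∧ ‖z - w‖ ≤ ε) : 0 ≤ z := by
  have : z ∈ closure (Set.Ici (0 : ℂ)) := by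
    rw [Metric.mem_closure_iff]
    intro ε hε
    obtain ⟨w, hw, hzw⟩ := h (ε / 2) (by positivity)
    exact ⟨w, hw, by rw [dist_eq_norm]; linarith⟩
  rwa [isClosed_Ici.closure_eq] at this

lemma tendsto_truncation_product (m : HSModel e H) (y : H) :
    Filter.Tendsto (fun s : Finset ι => truncation m.basis (s ×ˢ s) y) Filter.atTop (nhds y) := by
  refine (tendsto_truncation m.basis y).comp (Filter.tendsto_atTop_finset_of_monotone ?_ ?_)
  · exact fun s t h => Finset.product_subset_product h h
  · classical
    exact fun a => ⟨{a.1, a.2}, by simp⟩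

lemma truncation_product_eq (m : HSModel e H) (s : Finset ι) (y : H) :
    truncation m.basis (s ×ˢ s) y = ∑ a ∈ s ×ˢ s, m.ket (⟪m.basis a, y⟫ • e a.1) (e a.2) := by
  simp [truncation_apply, m.ket_smul]

lemma isPositive_of_mem_schmidtCone {ιH : Type*} (bH : HilbertBasis ιH ℂ H) {m : HSModel e H}
    {k : ℕ} {R : H →L[ℂ] H} (hR : IsTraceClass R) (hRk : R ∈ SchmidtCone m k)
    {φ : (K →L[ℂ] K) →ₗ[ℂ] (K →L[ℂ] K)} {Φ Φst : (H →L[ℂ] H) →ₗ[ℂ] (H →L[ℂ] H)}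
    (hφ : kPos k φ) (hΦ : HSExt m φ Φ) (hst : IsNormalPair bH Φ Φst) : (Φst R).IsPositive := by
  have key : ∀ (s : Finset (ι × ι)) (p q : ι × ι → K),
      0 ≤ ⟪∑ a ∈ s, m.ket (p a) (q a), Φst R (∑ a ∈ s, m.ket (p a) (q a))⟫ := by
    intro s p q
    set y := ∑ a ∈ s, m.ket (p a) (q a)
    rw [← pairing_rankOne_left bH, ← hst.2 _ _ hR]
    set A := Φ (rankOne y y)
    refine nonneg_of_forall_exists_norm_sub_le fun ε hε => ?_
    obtain ⟨n, x, hx, hlt⟩ := hRk (ε / (‖A‖ + 1)) (by positivity)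
    obtain ⟨c, hc, hrep⟩ := exists_nuclearRep_lt (isTraceClass_sub_sum_rankOne hR x) hlt
    have htc : ∀ i, IsTraceClass (rankOne (x i) (x i)) := fun i =>
      (NuclearRep.rankOne _ _).isTraceClass
    refine ⟨pairing bH A (∑ i, rankOne (x i) (x i)), ?_, ?_⟩
    · rw [pairing_sum_right bH htc]
      refine Finset.sum_nonneg fun i _ => ?_
      rw [pairing_rankOne_right]
      exact hΦ.inner_nonneg hφ (hx i) s p q
    · have h1 : pairing bH A R = pairing bH A (R - ∑ i, rankOne (x i) (x i))
          + pairing bH A (∑ i, rankOne (x i) (x i)) := by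
        rw [← pairing_add_right bH hrep.isTraceClass (isTraceClass_sum _ htc), sub_add_cancel]
      rw [h1, add_sub_cancel_right]
      refine (norm_pairing_le bH hrep A).trans ?_
      rw [lt_div_iff₀ (by positivity)] at hc
      nlinarith [hrep.nonneg]
  refine isPositive_of_inner_nonneg fun y => ?_
  have hy := tendsto_truncation_product m y
  refine ge_of_tendsto (hy.inner (((Φst R).continuous.tendsto y).comp hy))
    (Filter.Eventually.of_forall fun s => ?_)
  simp only [Function.comp_apply, truncation_product_eq]
  exact key _ _ _

end Forward

section Backward

variable {K : Type*} [NormedAddCommGroup K] [InnerProductSpace ℂ K] [CompleteSpace K]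
  {H : Type*} [NormedAddCommGroup H] [InnerProductSpace ℂ H] [CompleteSpace H]
  {ι : Type*} {e : HilbertBasis ι ℂ K}

lemma posSemidef_of_forall_nonneg {n : Type*} [Fintype n] {M : Matrix n n ℂ}
    (h : ∀ x : n → ℂ, 0 ≤ ∑ i, ∑ j, star (x i) * M i j * x j) : M.PosSemidef := by
  classical
  have h' : ∀ x : n → ℂ, 0 ≤ star x ⬝ᵥ M.mulVec x := fun x => by
    refine (h x).trans_eq ?_
    simp [dotProduct, Matrix.mulVec, Finset.mul_sum, mul_assoc]
  refine .of_dotProduct_mulVec_nonneg ?_ h'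
  rw [← Matrix.isSymmetric_toEuclideanLin_iff, LinearMap.isSymmetric_iff_inner_map_self_real]
  intro v
  have := (h' v.ofLp).isSelfAdjoint.star_eq
  rw [← inner_conj_symm, EuclideanSpace.inner_eq_star_dotProduct, dotProduct_comm,
    Matrix.ofLp_toLpLin, Matrix.toLin'_apply]
  simpa using congrArg star this

lemma MatPos.exists_eq_sum {k : ℕ} {A : Fin k → Fin k → (K →L[ℂ] K)} (hA : MatPos A)
    {n : Type*} [Fintype n] (ε : n → K) :
    ∃ (N : ℕ) (w : Fin N → Fin k × n → ℂ), ∀ s t i j,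
      ⟪ε i, A s t (ε j)⟫ = ∑ r, w r (s, i) * star (w r (t, j)) := by
  classical
  have h : (Matrix.of fun a b : Fin k × n => ⟪ε a.2, A a.1 b.1 (ε b.2)⟫).PosSemidef := by
    refine posSemidef_of_forall_nonneg fun x => ?_
    refine (hA fun s => ∑ i, x (s, i) • ε i).trans_eq ?_
    simp only [map_sum, map_smul, inner_sum, sum_inner, inner_smul_left, inner_smul_right,
      Fintype.sum_prod_type, Matrix.of_apply]
    refine Finset.sum_congr rfl fun s _ => ?_
    symm
    rw [Finset.sum_comm]
    refine Finset.sum_congr rfl fun t _ => ?_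
    rw [Finset.sum_comm]
    refine Finset.sum_congr rfl fun j _ => ?_
    rw [Finset.mul_sum]
    exact Finset.sum_congr rfl fun i _ => by rw [RCLike.star_def]; ring
  obtain ⟨N, w, hw⟩ := Matrix.posSemidef_iff_eq_sum_vecMulVec.1 h
  refine ⟨N, w, fun s t i j => ?_⟩
  have := congrFun (congrFun hw (s, i)) (t, j)
  simpa [Matrix.sum_apply, Matrix.vecMulVec_apply] using this
lemma kPos_elementary {n : Type*} [Fintype n] (ε : n → K) {k : ℕ} (q : n × n → n × n → ℂ)
    (hq : ∀ X : n × n → ℂ, rankLE (∑ a, X a • rankOne (ε a.1) (ε a.2)) k →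
      0 ≤ ∑ a, ∑ b, q a b * (star (X a) * X b)) :
    kPos k (elementary (fun p : (n × n) × (n × n) => q p.1 p.2 • rankOne (ε p.1.1) (ε p.1.2))
      fun p => rankOne (ε p.2.2) (ε p.2.1)) := by
  intro A hA v
  obtain ⟨N, w, hw⟩ := hA.exists_eq_sum ε
  let X : Fin N → n × n → ℂ := fun r b => ∑ t, ⟪ε b.1, v t⟫ * star (w r (t, b.2))
  have hX : ∀ r, rankLE (∑ a, X r a • rankOne (ε a.1) (ε a.2)) k := by
    intro r
    have : ∑ a, X r a • rankOne (ε a.1) (ε a.2)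
        = ∑ t, rankOne (∑ i, ⟪ε i, v t⟫ • ε i) (∑ j, w r (t, j) • ε j) := by
      ext z
      simp only [X, Fintype.sum_prod_type, _root_.sum_apply, smul_apply, rankOne_apply, sum_inner,
        inner_smul_left, Finset.sum_smul, Finset.smul_sum, smul_smul]
      rw [Finset.sum_comm_cycle]
      refine Finset.sum_congr rfl fun t _ => ?_
      refine Finset.sum_congr rfl fun i _ => ?_
      rw [Finset.sum_mul, Finset.sum_smul]
      refine Finset.sum_congr rfl fun j _ => ?_
      rw [RCLike.star_def]
      congr 1
      ring
    rw [this]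
    exact rankLE_sum_rankOne _ _
  refine (Finset.sum_nonneg (s := Finset.univ) fun r _ => hq (X r) (hX r)).trans_eq ?_
  beta_reduce
  simp only [elementary_apply, _root_.sum_apply, inner_sum]
  symm
  rw [Finset.sum_comm_cycle, Fintype.sum_prod_type, Finset.sum_comm (γ := Fin N)]
  refine Finset.sum_congr rfl fun a _ => ?_
  rw [Finset.sum_comm (γ := Fin N)]
  refine Finset.sum_congr rfl fun b _ => ?_
  simp only [mul_def, comp_apply, smul_apply, rankOne_apply, map_smul, inner_smul_right, hw, X,
    star_sum, star_mul', star_star, Finset.sum_mul_sum]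
  simp only [Finset.mul_sum, Finset.sum_mul]
  symm
  rw [← Finset.sum_comm_cycle]
  refine Finset.sum_congr rfl fun s _ => Finset.sum_congr rfl fun t _ =>
    Finset.sum_congr rfl fun r _ => ?_
  rw [RCLike.star_def, inner_conj_symm]
  ring

end Backward

section Separation

variable {K : Type*} [NormedAddCommGroup K] [InnerProductSpace ℂ K] [CompleteSpace K]
  {H : Type*} [NormedAddCommGroup H] [InnerProductSpace ℂ H] [CompleteSpace H]
  {ι : Type*} {e : HilbertBasis ι ℂ K} {ιH : Type*} {n : Type*} [Fintype n]

lemma adjoint_rankOne (x y : K) : adjoint (rankOne x y) = rankOne y x := by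
  symm
  rw [eq_adjoint_iff]
  intro u v
  simp [inner_smul_left, inner_smul_right, mul_comm]

lemma HSModel.Lmul_smul (m : HSModel e H) (c : ℂ) (a : K →L[ℂ] K) (y : H) :
    m.Lmul (c • a) y = c • m.Lmul a y := by
  apply m.inj
  ext z
  simp [m.Lmul_eq]

lemma HSModel.Lmul_rankOne_sum (m : HSModel e H) {ε : n → K} (hε : Orthonormal ℂ ε) (i j : n) :
    m.Lmul (rankOne (ε i) (ε j)) (∑ l, m.ket (ε l) (ε l)) = m.ket (ε i) (ε j) := by
  classical
  simp only [map_sum, m.Lmul_ket, rankOne_apply, m.ket_smul, orthonormal_iff_ite.1 hε]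
  simp

lemma rankLE.smul {T : K →L[ℂ] K} {k : ℕ} (h : rankLE T k) (c : ℂ) : rankLE (c • T) k := by
  refine (Submodule.rank_mono ?_).trans h
  rintro _ ⟨z, rfl⟩
  exact ⟨c • z, by simp⟩

lemma sum_mul_inner_nonneg {bH : HilbertBasis ιH ℂ H} {m : HSModel e H} {k : ℕ} {R : H →L[ℂ] H}
    (h : ∀ (φ : (K →L[ℂ] K) →ₗ[ℂ] (K →L[ℂ] K)) (Φ Φst : (H →L[ℂ] H) →ₗ[ℂ] (H →L[ℂ] H)),
      kPos k φ → NormalCB e φ → HSExt m φ Φ → IsNormalPair bH Φ Φst → (Φst R).IsPositive)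
    {ε : n → K} (hε : Orthonormal ℂ ε) (q : n × n → n × n → ℂ)
    (hq : ∀ X : n × n → ℂ, rankLE (∑ a, X a • rankOne (ε a.1) (ε a.2)) k →
      0 ≤ ∑ a, ∑ b, q a b * (star (X a) * X b)) :
    0 ≤ ∑ a, ∑ b, q a b * ⟪m.ket (ε b.1) (ε b.2), R (m.ket (ε a.1) (ε a.2))⟫ := by
  have := (h _ _ _ (kPos_elementary ε q hq)
    ⟨⟨_, isNormalPair_elementary e _ _⟩, isCBFullK_elementary _ _⟩ (m.hsExt_elementary _ _)
    (isNormalPair_elementary bH _ _)).inner_nonneg_right (∑ l, m.ket (ε l) (ε l))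
  refine this.trans_eq ?_
  simp only [elementary_apply, _root_.sum_apply, inner_sum, mul_def, comp_apply,
    Fintype.sum_prod_type (α₁ := n × n)]
  refine Finset.sum_congr rfl fun a _ => Finset.sum_congr rfl fun b _ => ?_
  rw [m.Lmul_smul, m.Lmul_rankOne_sum hε, ← adjoint_rankOne, ← m.inner_Lmul_left,
    m.Lmul_rankOne_sum hε, map_smul, inner_smul_right]

lemma exists_sum_mul_eq {I : Type*} [Fintype I] (f : (I → I → ℂ) →ₗ[ℝ] ℝ) :
    ∃ c : I → I → ℂ, ∀ M : I → I → ℂ, (∀ a b, star (M a b) = M b a) →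
      ∑ a, ∑ b, c a b * M a b = f M := by
  classical
  let g : I → I → ℂ := fun a b =>
    Module.Dual.extendRCLike (𝕜 := ℂ) f (Pi.single a (Pi.single b 1))
  refine ⟨fun a b => (g a b + star (g b a)) / 2, fun M hM => ?_⟩
  have hg : Module.Dual.extendRCLike (𝕜 := ℂ) f M = ∑ a, ∑ b, g a b * M a b := by
    have : M = ∑ a, ∑ b, M a b • (Pi.single a (Pi.single b 1) : I → I → ℂ) := by
      ext i j
      simp [Finset.sum_apply, Pi.single_apply, ite_apply]
    conv_lhs => rw [this]
    simp only [map_sum, map_smul, smul_eq_mul, mul_comm, g]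
  have hre : (f M : ℂ) = (Module.Dual.extendRCLike (𝕜 := ℂ) f M
      + star (Module.Dual.extendRCLike (𝕜 := ℂ) f M)) / 2 := by
    rw [RCLike.star_def, Complex.add_conj]
    have : (Module.Dual.extendRCLike (𝕜 := ℂ) f M).re = f M := by
      rw [← RCLike.re_eq_complex_re]
      exact Module.Dual.re_extendRCLike_apply f M
    rw [this]
    simp
  have hstar : star (∑ a, ∑ b, g a b * M a b) = ∑ a, ∑ b, star (g b a) * M a b := by
    simp only [star_sum, star_mul', hM]
    exact Finset.sum_comm
  rw [hre, hg, hstar, ← Finset.sum_add_distrib, Finset.sum_div]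
  refine Finset.sum_congr rfl fun a _ => ?_
  rw [← Finset.sum_add_distrib, Finset.sum_div]
  exact Finset.sum_congr rfl fun b _ => by ring

lemma exists_norm_inner_sub_sum_lt {bH : HilbertBasis ιH ℂ H} {m : HSModel e H} {k : ℕ}
    {R : H →L[ℂ] H} (hR : R.IsPositive)
    (h : ∀ (φ : (K →L[ℂ] K) →ₗ[ℂ] (K →L[ℂ] K)) (Φ Φst : (H →L[ℂ] H) →ₗ[ℂ] (H →L[ℂ] H)),
      kPos k φ → NormalCB e φ → HSExt m φ Φ → IsNormalPair bH Φ Φst → (Φst R).IsPositive)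
    {ε : n → K} (hε : Orthonormal ℂ ε) {δ : ℝ} (hδ : 0 < δ) :
    ∃ (N : ℕ) (X : Fin N → n × n → ℂ),
      (∀ r, rankLE (∑ a, X r a • rankOne (ε a.1) (ε a.2)) k) ∧
      ∀ a b, ‖⟪m.ket (ε a.1) (ε a.2), R (m.ket (ε b.1) (ε b.2))⟫
        - ∑ r, X r a * star (X r b)‖ < δ := by
  let S : Set (n × n → n × n → ℂ) := {M | ∃ X : n × n → ℂ,
    rankLE (∑ a, X a • rankOne (ε a.1) (ε a.2)) k ∧ M = fun a b => X a * star (X b)}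
  let C : PointedCone ℝ (n × n → n × n → ℂ) := PointedCone.hull ℝ S
  let ρ : n × n → n × n → ℂ := fun a b => ⟪m.ket (ε a.1) (ε a.2), R (m.ket (ε b.1) (ε b.2))⟫
  have hρ : ρ ∈ closure (C : Set (n × n → n × n → ℂ)) := by
    by_contra hmem
    obtain ⟨f, hf, hf0⟩ := ProperCone.hyperplane_separation_point
      (Submodule.closure C : ProperCone ℝ (n × n → n × n → ℂ)) (x₀ := ρ) hmem
    obtain ⟨c, hc⟩ := exists_sum_mul_eq (f : (n × n → n × n → ℂ) →ₗ[ℝ] ℝ)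
    have h1 := sum_mul_inner_nonneg h hε (fun a b => c b a) fun X hX => by
      have hS : (fun a b => X a * star (X b)) ∈ C := Submodule.subset_span ⟨X, hX, rfl⟩
      have hS' := hf _ (Submodule.le_topologicalClosure C hS)
      have hsum := hc (fun a b => X a * star (X b)) fun a b => by simp [mul_comm]
      rw [Finset.sum_comm]
      refine (Complex.zero_le_real.2 hS').trans_eq (hsum.symm.trans ?_)
      exact Finset.sum_congr rfl fun a _ => Finset.sum_congr rfl fun b _ => by ring
    rw [Finset.sum_comm] at h1
    have h2 := hc ρ fun a b => by
      rw [RCLike.star_def, inner_conj_symm]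
      exact hR.isSymmetric _ _
    rw [h2, Complex.zero_le_real] at h1
    exact absurd h1 (not_le.2 hf0)
  obtain ⟨M, hM, hdist⟩ := Metric.mem_closure_iff.1 hρ δ hδ
  obtain ⟨N, t, g, hsum⟩ := Submodule.mem_span_set'.1 hM
  choose X hX hgX using fun r => (g r).2
  refine ⟨N, fun r a => (Real.sqrt (t r) : ℂ) * X r a, fun r => ?_, fun a b => ?_⟩
  · simp only [mul_smul, ← Finset.smul_sum]
    exact (hX r).smul _
  · have : ∑ r, (Real.sqrt (t r) : ℂ) * X r a * star ((Real.sqrt (t r) : ℂ) * X r b) = M a b := by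
      rw [← hsum]
      simp only [Finset.sum_apply, Pi.smul_apply, hgX, star_mul']
      refine Finset.sum_congr rfl fun r _ => ?_
      have ht : (Real.sqrt (t r) : ℂ) * (Real.sqrt (t r) : ℂ) = ((t r : ℝ) : ℂ) := by
        rw [← Complex.ofReal_mul, Real.mul_self_sqrt (t r).2]
      rw [RCLike.star_def, Complex.conj_ofReal]
      change _ = (t r : ℝ) • (X r a * star (X r b))
      rw [Complex.real_smul, ← ht, RCLike.star_def]
      ring
    rw [this, ← dist_eq_norm]
    exact (dist_le_pi_dist (ρ a) (M a) b).trans_lt ((dist_le_pi_dist ρ M a).trans_lt hdist)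

end Separation

section Approximation

variable {K : Type*} [NormedAddCommGroup K] [InnerProductSpace ℂ K] [CompleteSpace K]
  {H : Type*} [NormedAddCommGroup H] [InnerProductSpace ℂ H] [CompleteSpace H]
  {ι : Type*} {e : HilbertBasis ι ℂ K} {ιH : Type*}

lemma exists_nuclearRep_sub_compression_lt {κ α : Type*} {b : HilbertBasis κ ℂ H}
    {l : Filter α} [l.NeBot] {F : α → Finset κ}
    (hF : ∀ y, Filter.Tendsto (fun a => truncation b (F a) y) l (nhds y))
    {R : H →L[ℂ] H} (hR : IsTraceClass R) {δ : ℝ} (hδ : 0 < δ) :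
    ∃ a, ∃ c < δ, NuclearRep (R - truncation b (F a) * R * truncation b (F a)) c := by
  obtain ⟨d, x, y, hd, hz⟩ := isTraceClass_iff.1 hR
  have hP : ∀ a z, ‖truncation b (F a) z‖ ≤ ‖z‖ := fun a z => norm_truncation_le b.orthonormal _ _
  have hP2 : ∀ a z, ‖z - truncation b (F a) z‖ ≤ 2 * ‖z‖ := fun a z => by
    linarith [norm_sub_le z (truncation b (F a) z), hP a z]
  have hlim : ∀ z, Filter.Tendsto (fun a => ‖z - truncation b (F a) z‖) l (nhds 0) := fun z => by
    simpa using ((tendsto_const_nhds (x := z)).sub (hF z)).norm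
  have hsum : Summable fun n => 2 * (‖x n‖ * ‖y n‖) := hd.summable.mul_left 2
  have hle1 : ∀ a n, ‖x n - truncation b (F a) (x n)‖ * ‖y n‖ ≤ 2 * (‖x n‖ * ‖y n‖) :=
    fun a n => by
      rw [← mul_assoc]
      exact mul_le_mul_of_nonneg_right (hP2 a _) (norm_nonneg _)
  have hle2 : ∀ a n, ‖truncation b (F a) (x n)‖ * ‖y n - truncation b (F a) (y n)‖
      ≤ 2 * (‖x n‖ * ‖y n‖) := fun a n => by
    rw [mul_left_comm]
    exact mul_le_mul (hP a _) (hP2 a _) (norm_nonneg _) (norm_nonneg _)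
  have hlim1 : Filter.Tendsto
      (fun a => ∑' n, ‖x n - truncation b (F a) (x n)‖ * ‖y n‖) l (nhds 0) := by
    rw [← tsum_zero (α := ℝ) (β := ℕ)]
    refine tendsto_tsum_of_dominated_convergence hsum (fun n => ?_) (.of_forall fun a n => ?_)
    · simpa using (hlim (x n)).mul_const ‖y n‖
    · rw [Real.norm_of_nonneg (by positivity)]
      exact hle1 a n
  have hlim2 : Filter.Tendsto
      (fun a => ∑' n, ‖truncation b (F a) (x n)‖ * ‖y n - truncation b (F a) (y n)‖)
      l (nhds 0) := by
    rw [← tsum_zero (α := ℝ) (β := ℕ)]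
    refine tendsto_tsum_of_dominated_convergence hsum (fun n => ?_) (.of_forall fun a n => ?_)
    · simpa using (hF (x n)).norm.mul (hlim (y n))
    · rw [Real.norm_of_nonneg (by positivity)]
      exact hle2 a n
  have hlim3 := hlim1.add hlim2
  rw [add_zero] at hlim3
  obtain ⟨a, ha⟩ := (hlim3.eventually (gt_mem_nhds hδ)).exists
  set P := truncation b (F a) with hPdef
  have hsa : ∀ u v, ⟪P u, v⟫ = ⟪u, P v⟫ := fun u v => by
    rw [inner_truncation_left, inner_truncation_right]
  refine ⟨a, _, ha, ?_⟩
  have h1 : NuclearRep (R - P * R) (∑' n, ‖x n - P (x n)‖ * ‖y n‖) := by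
    refine ⟨_, _, (Summable.of_nonneg_of_le (fun n => by positivity) (hle1 a) hsum).hasSum,
      fun z => ?_⟩
    simpa [smul_sub] using (hz z).sub ((hz z).mapL P)
  have h2 : NuclearRep (P * R - P * R * P) (∑' n, ‖P (x n)‖ * ‖y n - P (y n)‖) := by
    refine ⟨_, _, (Summable.of_nonneg_of_le (fun n => by positivity) (hle2 a) hsum).hasSum,
      fun z => ?_⟩
    simpa [sub_smul, inner_sub_left, ← hPdef, hsa] using ((hz z).mapL P).sub ((hz (P z)).mapL P)
  simpa using h1.add h2

lemma truncation_mul_mul {κ : Type*} (b : κ → H) (s : Finset κ) (R : H →L[ℂ] H) :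
    truncation b s * R * truncation b s
      = ∑ i ∈ s, ∑ j ∈ s, ⟪b i, R (b j)⟫ • rankOne (b i) (b j) := by
  ext z
  simp only [mul_def, comp_apply, truncation_apply, map_sum, map_smul, _root_.sum_apply,
    smul_apply, rankOne_apply, smul_smul, Finset.smul_sum]
  rw [Finset.sum_comm]
  exact Finset.sum_congr rfl fun i _ => Finset.sum_congr rfl fun j _ => by rw [mul_comm]

lemma rankOne_sum_smul {I : Type*} [Fintype I] (E : I → H) (X : I → ℂ) :
    rankOne (∑ a, X a • E a) (∑ a, X a • E a)
      = ∑ a, ∑ b, (X a * star (X b)) • rankOne (E a) (E b) := by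
  ext z
  simp only [rankOne_apply, sum_inner, inner_smul_left, Finset.smul_sum, Finset.sum_mul,
    Finset.sum_smul, _root_.sum_apply, smul_apply, smul_smul]
  refine Finset.sum_congr rfl fun a _ => Finset.sum_congr rfl fun b _ => ?_
  rw [RCLike.star_def]
  congr 1
  ring

lemma nuclearRep_sum_smul_rankOne {I : Type*} [Fintype I] {E : I → H} (hE : ∀ a, ‖E a‖ = 1)
    (M : I → I → ℂ) :
    NuclearRep (∑ a, ∑ b, M a b • rankOne (E a) (E b)) (∑ a, ∑ b, ‖M a b‖) := by
  refine NuclearRep.sum _ fun a _ => NuclearRep.sum _ fun b _ => ?_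
  have h1 : M a b • rankOne (E a) (E b) = rankOne (M a b • E a) (E b) := by
    ext z
    simp only [smul_apply, rankOne_apply]
    exact smul_comm _ _ _
  have h2 := NuclearRep.rankOne (M a b • E a) (E b)
  rwa [norm_smul, hE, hE, mul_one, mul_one, ← h1] at h2

lemma mem_schmidtCone_of_forall_isPositive {bH : HilbertBasis ιH ℂ H} {m : HSModel e H} {k : ℕ}
    {R : H →L[ℂ] H} (hRtc : IsTraceClass R) (hR : R.IsPositive)
    (h : ∀ (φ : (K →L[ℂ] K) →ₗ[ℂ] (K →L[ℂ] K)) (Φ Φst : (H →L[ℂ] H) →ₗ[ℂ] (H →L[ℂ] H)),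
      kPos k φ → NormalCB e φ → HSExt m φ Φ → IsNormalPair bH Φ Φst → (Φst R).IsPositive) :
    R ∈ SchmidtCone m k := by
  intro δ hδ
  obtain ⟨s, c, hc, hrep⟩ := exists_nuclearRep_sub_compression_lt
    (tendsto_truncation_product m) hRtc (half_pos hδ)
  have hε : Orthonormal ℂ fun i : s => e i := e.orthonormal.comp _ Subtype.val_injective
  let E : s × s → H := fun a => m.ket (e a.1) (e a.2)
  set d : ℝ := (Fintype.card (s × s) : ℝ) with hd_def
  have hd : 0 ≤ d := Nat.cast_nonneg _
  obtain ⟨N, X, hX, hlt⟩ := exists_norm_inner_sub_sum_lt hR h hε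
    (show 0 < δ / 2 / (d * d + 1) by positivity)
  refine ⟨N, fun r => ∑ a, X r a • E a, fun r => ?_, ?_⟩
  · simpa [E] using hX r
  have hE : ∀ a, ‖E a‖ = 1 := (m.orthonormal_ket hε).1
  have hrep2 := nuclearRep_sum_smul_rankOne hE
    fun a b => ⟪E a, R (E b)⟫ - ∑ r, X r a * star (X r b)
  have hcomp : truncation m.basis (s ×ˢ s) * R * truncation m.basis (s ×ˢ s)
      = ∑ a, ∑ b, ⟪E a, R (E b)⟫ • rankOne (E a) (E b) := by
    rw [truncation_mul_mul]
    simp only [Finset.sum_product, Fintype.sum_prod_type, m.basis_apply, E]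
    simp only [← Finset.sum_coe_sort s]
  have hX2 : ∑ r, rankOne (∑ a, X r a • E a) (∑ a, X r a • E a)
      = ∑ a, ∑ b, (∑ r, X r a * star (X r b)) • rankOne (E a) (E b) := by
    simp only [rankOne_sum_smul, Finset.sum_smul]
    rw [Finset.sum_comm]
    exact Finset.sum_congr rfl fun a _ => Finset.sum_comm
  have htotal := hrep.add hrep2
  simp only [sub_smul, Finset.sum_sub_distrib] at htotal
  rw [← hcomp, ← hX2, sub_add_sub_cancel] at htotal
  refine (traceNorm_le htotal).trans_lt ?_
  have hbound : ∑ a, ∑ b, ‖⟪E a, R (E b)⟫ - ∑ r, X r a * star (X r b)‖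
      ≤ d * (d * (δ / 2 / (d * d + 1))) := by
    have : ∑ _a : s × s, ∑ _b : s × s, δ / 2 / (d * d + 1)
        = d * (d * (δ / 2 / (d * d + 1))) := by simp [hd_def]
    rw [← this]
    exact Finset.sum_le_sum fun a _ => Finset.sum_le_sum fun b _ => (hlt a b).le
  have : d * (d * (δ / 2 / (d * d + 1))) ≤ δ / 2 := by
    rw [← mul_assoc, mul_div_assoc', div_le_iff₀ (by positivity)]
    nlinarith
  linarith

end Approximation

/-- Corollary 5.4.  A normal positive functional `ρ` on
`B(H)` — implemented by a positive trace class operator `R` — has Schmidt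
number not bigger than `k` if and only if `φ̃_*(ρ)` is positive for every
`k`-positive map `φ ∈ P^σ_k`. -/
theorem statement14
    {K : Type*} [NormedAddCommGroup K] [InnerProductSpace ℂ K] [CompleteSpace K]
    [TopologicalSpace.SeparableSpace K]
    {ι : Type*} (e : HilbertBasis ι ℂ K)
    {H : Type*} [NormedAddCommGroup H] [InnerProductSpace ℂ H] [CompleteSpace H]
    {ιH : Type*} (bH : HilbertBasis ιH ℂ H)
    (m : HSModel e H) (x0 : H) (hx0 : ‖x0‖ = 1)
    (hcyc : Dense {y : H | ∃ a : K →L[ℂ] K, m.Lmul a x0 = y})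
    (hsep : ∀ a : K →L[ℂ] K, m.Lmul a x0 = 0 → m.Lmul a = 0)
    (k : ℕ) (R : H →L[ℂ] H) (hRtc : IsTraceClass R) (hRpos : R.IsPositive) :
    R ∈ SchmidtCone m k ↔
      ∀ (φ : (K →L[ℂ] K) →ₗ[ℂ] (K →L[ℂ] K)) (Φ Φst : (H →L[ℂ] H) →ₗ[ℂ] (H →L[ℂ] H)),
        kPos k φ → NormalCB e φ → HSExt m φ Φ → IsNormalPair bH Φ Φst →
        (Φst R).IsPositive := by
  exact ⟨fun h _ _ _ hφ _ hΦ hst => isPositive_of_mem_schmidtCone bH hRtc h hφ hΦ hst,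
    mem_schmidtCone_of_forall_isPositive hRtc hRpos⟩

end ChoiInf
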